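/- Let q, λ, μ ∈ ℂ with q nonzero and not a root of unity, λ ≠ 0, μ ≠ 0, and suppose (μ;q)_t ≠ 0 and (μ;q)_r ≠ 0 for all r ≤ min(s,t). Define f(s,t;λ,μ) = Σ_{i=0}^{t} q^{s·i} (μ/λ)^i (λ;q)_i (μ/λ;q)_{t−i} binom(t,i)_q / (μ;q)_t for s,t ∈ ℕ. Then f(s,t;λ,μ) = Σ_{r=0}^{min(s,t)} (−1)^r q^{r(r−1)/2} (μ/λ)^r (q;q)_r binom(s,r)_q binom(t,r)_q (λ;q)_r/(μ;q)_r; in particular this expression is manifestly symmetric in s and t. -/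

import Mathlib

/-- The q-Pochhammer symbol `(z;q)_m = ∏_{j=0}^{m-1} (1 - z q^j)`. -/
noncomputable def qPoch (q z : ℂ) (m : ℕ) : ℂ := ∏ j ∈ Finset.range m, (1 - z * q ^ j)

/-- The q-binomial coefficient `binom(m,k)_q`. -/
noncomputable def qBinom (q : ℂ) (m k : ℕ) : ℂ :=
  if k ≤ m then qPoch q q m / (qPoch q q k * qPoch q q (m - k)) else 0

/-- `q` is not a root of unity. -/
def notRootOfUnity (q : ℂ) : Prop := ∀ m : ℕ, 0 < m → q ^ m ≠ 1

/-- `f(s,t;λ,μ) = Σ_{i=0}^{t} q^{s i} (μ/λ)^i (λ;q)_i (μ/λ;q)_{t−i} binom(t,i)_q / (μ;q)_t`. -/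
noncomputable def f (q lam mu : ℂ) (s t : ℕ) : ℂ :=
  ∑ i ∈ Finset.range (t + 1),
    q ^ (s * i) * (mu / lam) ^ i * qPoch q lam i * qPoch q (mu / lam) (t - i) *
      qBinom q t i / qPoch q mu t

theorem qPoch_zero (q z : ℂ) : qPoch q z 0 = 1 := by simp [qPoch]

theorem qPoch_add (q z : ℂ) (m n : ℕ) :
    qPoch q z (m + n) = qPoch q z m * qPoch q (z * q ^ m) n := by
  simp only [qPoch, Finset.prod_range_add, pow_add, mul_assoc]

theorem qPoch_succ (q z : ℂ) (m : ℕ) :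
    qPoch q z (m + 1) = qPoch q z m * (1 - z * q ^ m) := by
  simp [qPoch, Finset.prod_range_succ]

theorem qPoch_succ' (q z : ℂ) (m : ℕ) :
    qPoch q z (m + 1) = (1 - z) * qPoch q (z * q) m := by
  rw [add_comm, qPoch_add]
  simp [qPoch]

theorem qPoch_self_ne_zero {q : ℂ} (hq : notRootOfUnity q) (m : ℕ) : qPoch q q m ≠ 0 := by
  refine Finset.prod_ne_zero_iff.2 fun j _ h => hq (j + 1) j.succ_pos ?_
  rw [pow_succ']
  exact (sub_eq_zero.1 h).symm

theorem qBinom_add_left {q : ℂ} (m k : ℕ) :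
    qBinom q (k + m) k = qPoch q q (k + m) / (qPoch q q k * qPoch q q m) := by
  simp [qBinom]

theorem qBinom_of_lt (q : ℂ) {m k : ℕ} (h : m < k) : qBinom q m k = 0 := by
  simp [qBinom, h]

theorem qBinom_zero_right {q : ℂ} (hq : notRootOfUnity q) (m : ℕ) : qBinom q m 0 = 1 := by
  simp [qBinom, qPoch_zero, qPoch_self_ne_zero hq m]

theorem qBinom_self {q : ℂ} (hq : notRootOfUnity q) (m : ℕ) : qBinom q m m = 1 := by
  simp [qBinom, qPoch_zero, qPoch_self_ne_zero hq m]

/-- The q-Pascal rule. -/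
theorem qBinom_succ_succ {q : ℂ} (hq : notRootOfUnity q) (m k : ℕ) :
    qBinom q (m + 1) (k + 1) = q ^ (k + 1) * qBinom q m (k + 1) + qBinom q m k := by
  rcases lt_trichotomy m k with h | rfl | h
  · rw [qBinom_of_lt q (by omega), qBinom_of_lt q (by omega), qBinom_of_lt q h]
    simp
  · rw [qBinom_self hq, qBinom_self hq, qBinom_of_lt q (by omega)]
    simp
  · obtain ⟨n, rfl⟩ := Nat.exists_eq_add_of_lt h
    have h₁ := qBinom_add_left (q := q) (n + 1) (k + 1)
    have h₂ := qBinom_add_left (q := q) n (k + 1)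
    have h₃ := qBinom_add_left (q := q) (n + 1) k
    rw [show k + 1 + (n + 1) = k + n + 1 + 1 by ring, qPoch_succ q q (k + n + 1)] at h₁
    rw [show k + 1 + n = k + n + 1 by ring] at h₂
    rw [← add_assoc] at h₃
    have hk := qPoch_self_ne_zero hq (k + 1)
    have hn := qPoch_self_ne_zero hq (n + 1)
    rw [qPoch_succ] at hk hn
    rw [h₁, h₂, h₃, qPoch_succ q q k, qPoch_succ q q n]
    have hk₁ := left_ne_zero_of_mul hk
    have hk₂ := right_ne_zero_of_mul hk
    have hn₁ := left_ne_zero_of_mul hn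
    have hn₂ := right_ne_zero_of_mul hn
    field_simp
    ring

/-- Summation by the q-Pascal rule. -/
theorem sum_qBinom_succ {q : ℂ} (hq : notRootOfUnity q) (n : ℕ) (g : ℕ → ℂ) :
    ∑ k ∈ Finset.range (n + 2), qBinom q (n + 1) k * g k =
      ∑ k ∈ Finset.range (n + 1), qBinom q n k * (q ^ k * g k + g (k + 1)) := by
  have h : ∑ k ∈ Finset.range (n + 1), qBinom q n k * (q ^ k * g k) =
      ∑ k ∈ Finset.range (n + 1), q ^ (k + 1) * qBinom q n (k + 1) * g (k + 1) + g 0 := by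
    have h₁ := Finset.sum_range_succ (fun k => qBinom q n k * (q ^ k * g k)) (n + 1)
    rw [Finset.sum_range_succ', qBinom_of_lt q n.lt_succ_self, qBinom_zero_right hq] at h₁
    simp only [pow_zero, one_mul, zero_mul, add_zero] at h₁
    rw [← h₁]
    exact congrArg (· + g 0) (Finset.sum_congr rfl fun k _ => by ring)
  rw [Finset.sum_range_succ', qBinom_zero_right hq]
  simp only [qBinom_succ_succ hq, add_mul, mul_add, Finset.sum_add_distrib, h]
  ring

/-- The q-Chu–Vandermonde identity. -/
theorem sum_qBinom_mul_qPoch {q : ℂ} (hq : notRootOfUnity q) (n : ℕ) (a b : ℂ) :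
    ∑ k ∈ Finset.range (n + 1), qBinom q n k * (b ^ k * qPoch q a k * qPoch q b (n - k)) =
      qPoch q (a * b) n := by
  induction n generalizing a b with
  | zero => simp [qBinom_zero_right hq, qPoch_zero]
  | succ n ih =>
    rw [sum_qBinom_succ hq]
    have h₁ := ih a (b * q)
    have h₂ := ih (a * q) b
    rw [← mul_assoc] at h₁
    rw [mul_right_comm] at h₂
    rw [qPoch_succ', show 1 - a * b = (1 - b) + b * (1 - a) by ring, add_mul]
    nth_rewrite 1 [← h₁]
    rw [← h₂, Finset.mul_sum, Finset.mul_sum, ← Finset.sum_add_distrib]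
    refine Finset.sum_congr rfl fun k hk => ?_
    have hk : k ≤ n := Nat.lt_succ_iff.1 (Finset.mem_range.1 hk)
    rw [Nat.succ_sub hk, Nat.succ_eq_add_one, qPoch_succ' q b, qPoch_succ' q a,
      Nat.add_sub_add_right]
    ring

theorem pow_eq_sum_qBinom {q : ℂ} (hq : notRootOfUnity q) (x : ℂ) (s : ℕ) :
    x ^ s = ∑ r ∈ Finset.range (s + 1), qBinom q s r * ∏ j ∈ Finset.range r, (x - q ^ j) := by
  induction s with
  | zero => simp [qBinom_zero_right hq]
  | succ s ih =>
    rw [sum_qBinom_succ hq, pow_succ, ih, Finset.sum_mul]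
    refine Finset.sum_congr rfl fun r _ => ?_
    rw [Finset.prod_range_succ]
    ring

theorem prod_pow_sub_pow_mul_qPoch (q : ℂ) (r k : ℕ) :
    (∏ j ∈ Finset.range r, (q ^ (r + k) - q ^ j)) * qPoch q q k =
      (-1) ^ r * q ^ (r * (r - 1) / 2) * qPoch q q (r + k) := by
  induction r generalizing k with
  | zero => simp
  | succ r ih =>
    have h := ih (k + 1)
    rw [qPoch_succ, show r + (k + 1) = r + 1 + k by ring] at h
    rw [Finset.prod_range_succ, Nat.triangle_succ]
    linear_combination -(q ^ r) * h

theorem prod_pow_sub_pow_mul_qBinom {q : ℂ} (hq : notRootOfUnity q) (r : ℕ) {n k : ℕ}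
    (hk : k ≤ n) :
    (∏ j ∈ Finset.range r, (q ^ (r + k) - q ^ j)) * qBinom q (r + n) (r + k) =
      (-1) ^ r * q ^ (r * (r - 1) / 2) * qPoch q q r * qBinom q (r + n) r * qBinom q n k := by
  obtain ⟨m, rfl⟩ := Nat.exists_eq_add_of_le hk
  have h := prod_pow_sub_pow_mul_qPoch q r k
  rw [qBinom_add_left, qBinom_add_left, ← add_assoc, qBinom_add_left]
  have hk₀ := qPoch_self_ne_zero hq k
  have hm₀ := qPoch_self_ne_zero hq m
  have hr₀ := qPoch_self_ne_zero hq r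
  have hrk₀ := qPoch_self_ne_zero hq (r + k)
  have hkm₀ := qPoch_self_ne_zero hq (k + m)
  field_simp
  linear_combination qPoch q q (r + k + m) * h

theorem sum_prod_pow_sub_pow_mul_qBinom {q : ℂ} (hq : notRootOfUnity q) (a b : ℂ) (r n : ℕ) :
    ∑ i ∈ Finset.range (r + n + 1), (∏ j ∈ Finset.range r, (q ^ i - q ^ j)) *
        (b ^ i * qPoch q a i * qPoch q b (r + n - i) * qBinom q (r + n) i) =
      (-1) ^ r * q ^ (r * (r - 1) / 2) * b ^ r * qPoch q q r * qBinom q (r + n) r *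
        qPoch q a r * qPoch q (a * b * q ^ r) n := by
  rw [add_assoc, Finset.sum_range_add, Finset.sum_eq_zero, zero_add, mul_right_comm a b,
    ← sum_qBinom_mul_qPoch hq, Finset.mul_sum]
  · refine Finset.sum_congr rfl fun k hk => ?_
    have h := prod_pow_sub_pow_mul_qBinom hq r (Nat.lt_succ_iff.1 (Finset.mem_range.1 hk))
    rw [Nat.add_sub_add_left, qPoch_add, pow_add b]
    linear_combination (b ^ r * b ^ k * (qPoch q a r * qPoch q (a * q ^ r) k) *
      qPoch q b (n - k)) * h
  · intro i hi
    rw [Finset.prod_eq_zero hi (sub_self _), zero_mul]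

theorem f_eq_symmetric_sum (q lam mu : ℂ) (hq0 : q ≠ 0) (hq : notRootOfUnity q)
    (hlam : lam ≠ 0) (hmu : mu ≠ 0) (s t : ℕ)
    (ht : qPoch q mu t ≠ 0) (hr : ∀ r ≤ min s t, qPoch q mu r ≠ 0) :
    f q lam mu s t =
      ∑ r ∈ Finset.range (min s t + 1),
        (-1) ^ r * q ^ (r * (r - 1) / 2) * (mu / lam) ^ r * qPoch q q r *
          qBinom q s r * qBinom q t r * qPoch q lam r / qPoch q mu r := by
  have hab : lam * (mu / lam) = mu := mul_div_cancel₀ mu hlam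
  have hsub : Finset.range (min s t + 1) ⊆ Finset.range (s + 1) :=
    Finset.range_subset_range.2 (by omega)
  rw [Finset.sum_subset hsub]
  · simp only [f, pow_mul, fun i => pow_right_comm q s i]
    simp only [fun i => pow_eq_sum_qBinom hq (q ^ i) s, Finset.sum_mul, Finset.sum_div]
    rw [Finset.sum_comm]
    refine Finset.sum_congr rfl fun r _ => ?_
    rcases lt_or_ge t r with htr | hrt
    · rw [qBinom_of_lt q htr, Finset.sum_eq_zero]
      · simp
      · intro i hi
        rw [Finset.prod_eq_zero (Finset.mem_range.2 (by grind)) (sub_self (q ^ i))]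
        simp
    · obtain ⟨n, rfl⟩ := Nat.exists_eq_add_of_le hrt
      have h := sum_prod_pow_sub_pow_mul_qBinom hq lam (mu / lam) r n
      rw [hab] at h
      have ht' := ht
      rw [qPoch_add] at ht'
      have h₁ := left_ne_zero_of_mul ht'
      have h₂ := right_ne_zero_of_mul ht'
      trans qBinom q s r / qPoch q mu (r + n) * ∑ i ∈ Finset.range (r + n + 1),
        (∏ j ∈ Finset.range r, (q ^ i - q ^ j)) * ((mu / lam) ^ i * qPoch q lam i *
          qPoch q (mu / lam) (r + n - i) * qBinom q (r + n) i)
      · rw [Finset.mul_sum]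
        exact Finset.sum_congr rfl fun i _ => by ring
      · rw [h, qPoch_add q mu]
        generalize mu / lam = b
        field_simp
  · intro r hrs hrm
    rw [qBinom_of_lt q (m := t) (k := r) (by grind)]
    simp
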